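/- arXiv:1810.08662 — 4 statements merged into one kernel-verified Lean document; each statement's English description precedes it below -/
import Mathlib

section
/- Let A be an n×n matrix with nonnegative real entries such that Tr(A) ≤ 1. Then a positive vector x ∈ ℝⁿ (all entries > 0) satisfies max_{1≤j≤n} A_{ij}·x_j ≤ x_i for every i if and only if there exists a positive vector u ∈ ℝⁿ with x = A* ⊗ u, i.e., x_i = max_{1≤j≤n} (A*)_{ij}·u_j for every i. -/
open scoped BigOperators

noncomputable section

/-- Tropical (max-times) matrix product. -/
def tmul {n : ℕ} (A B : Matrix (Fin n) (Fin n) ℝ) : Matrix (Fin n) (Fin n) ℝ :=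
  Matrix.of fun i j => ⨆ k, A i k * B k j

/-- Tropical matrix power: `A^0 = I`, `A^(k+1) = A ⊗ A^k`. -/
def tpow {n : ℕ} (A : Matrix (Fin n) (Fin n) ℝ) : ℕ → Matrix (Fin n) (Fin n) ℝ
  | 0 => Matrix.of fun i j => if i = j then (1 : ℝ) else 0
  | k + 1 => tmul A (tpow A k)

/-- Tropical trace: `tr A = max_i A i i`. -/
def ttr {n : ℕ} (A : Matrix (Fin n) (Fin n) ℝ) : ℝ := ⨆ i, A i i

/-- `Tr(A) = max_{1 ≤ k ≤ n} tr (A^k)`. -/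
def tTr {n : ℕ} (A : Matrix (Fin n) (Fin n) ℝ) : ℝ :=
  ⨆ k : Fin n, ttr (tpow A (k.1 + 1))

/-- Tropical spectral radius: `λ(A) = max_{1 ≤ k ≤ n} (tr (A^k))^(1/k)`. -/
def specRad {n : ℕ} (A : Matrix (Fin n) (Fin n) ℝ) : ℝ :=
  ⨆ k : Fin n, (ttr (tpow A (k.1 + 1))) ^ ((1 : ℝ) / ((k.1 : ℝ) + 1))

/-- Kleene star: `A* = I ⊕ A ⊕ ⋯ ⊕ A^(n-1)` (entrywise max of tropical powers). -/
def kstar {n : ℕ} (A : Matrix (Fin n) (Fin n) ℝ) : Matrix (Fin n) (Fin n) ℝ :=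
  Matrix.of fun i j => ⨆ k : Fin n, tpow A k.1 i j

/-- `B ⊗ A^(i₁) ⊗ B ⊗ A^(i₂) ⊗ ⋯ ⊗ B ⊗ A^(i_k)` for a list `(i₁, …, i_k)`. -/
def wordProd {n : ℕ} (A B : Matrix (Fin n) (Fin n) ℝ) : List ℕ → Matrix (Fin n) (Fin n) ℝ
  | [] => tpow A 0
  | i :: l => tmul (tmul B (tpow A i)) (wordProd A B l)

/-- The function `G(s)` associated with matrices `A`, `B`. -/
def Gfun {n : ℕ} (A B : Matrix (Fin n) (Fin n) ℝ) (s : ℝ) : ℝ :=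
  sSup { v : ℝ | ∃ (k m : ℕ) (t : Fin k → ℕ),
    1 ≤ k ∧ k ≤ n - 1 ∧ 1 ≤ m ∧ m ≤ n - k ∧ (∑ j, t j) = m ∧
    v = s ^ (-(k : ℝ) / (m : ℝ)) *
      (ttr (wordProd A B (List.ofFn t))) ^ ((1 : ℝ) / (m : ℝ)) }

/-- The function `H(t)` associated with matrices `A`, `B`. -/
def Hfun {n : ℕ} (A B : Matrix (Fin n) (Fin n) ℝ) (t : ℝ) : ℝ :=
  sSup { v : ℝ | ∃ (k m : ℕ) (w : Fin k → ℕ),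
    1 ≤ k ∧ k ≤ n - 1 ∧ 1 ≤ m ∧ m ≤ n - k ∧ (∑ j, w j) = m ∧
    v = t ^ (-(m : ℝ) / (k : ℝ)) *
      (ttr (wordProd A B (List.ofFn w))) ^ ((1 : ℝ) / (k : ℝ)) }

/-- The objective `f(x) = max_{i,j} A i j * x j / x i`. -/
def obj {n : ℕ} (A : Matrix (Fin n) (Fin n) ℝ) (x : Fin n → ℝ) : ℝ :=
  ⨆ i, ⨆ j, A i j * x j / x i

/-- `x` is a positive Pareto-optimal point for minimizing `(obj A, obj B)`. -/
def ParetoOptimal {n : ℕ} (A B : Matrix (Fin n) (Fin n) ℝ) (x : Fin n → ℝ) : Prop :=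
  (∀ i, 0 < x i) ∧
    ¬ ∃ y : Fin n → ℝ, (∀ i, 0 < y i) ∧ obj A y ≤ obj A x ∧ obj B y ≤ obj B x ∧
      (obj A y, obj B y) ≠ (obj A x, obj B x)

/-- The Pareto frontier of the bi-objective problem. -/
def ParetoFrontier {n : ℕ} (A B : Matrix (Fin n) (Fin n) ℝ) : Set (ℝ × ℝ) :=
  { p | ∃ x : Fin n → ℝ, ParetoOptimal A B x ∧ p = (obj A x, obj B x) }

lemma bddF {m : ℕ} (f : Fin m → ℝ) : BddAbove (Set.range f) := (Set.finite_range f).bddAbove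

lemma tpow_nonneg {n : ℕ} (A : Matrix (Fin n) (Fin n) ℝ) (hA : ∀ i j, 0 ≤ A i j) (m : ℕ) :
    ∀ i j, 0 ≤ tpow A m i j := by
  induction m with
  | zero => intro i j; simp only [tpow, Matrix.of_apply]; split_ifs <;> norm_num
  | succ k ih =>
    intro i j
    simp only [tpow, tmul, Matrix.of_apply]
    exact Real.iSup_nonneg fun l => mul_nonneg (hA _ _) (ih _ _)

lemma le_tpow_succ {n : ℕ} (A : Matrix (Fin n) (Fin n) ℝ) (m : ℕ) (i j l : Fin n) :
    A i j * tpow A m j l ≤ tpow A (m + 1) i l := by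
  simp only [tpow, tmul, Matrix.of_apply]
  exact le_ciSup (f := fun k => A i k * tpow A m k l) (bddF _) j

lemma exists_tpow_succ {n : ℕ} (A : Matrix (Fin n) (Fin n) ℝ) (m : ℕ) (i l : Fin n) :
    ∃ j, tpow A (m + 1) i l = A i j * tpow A m j l := by
  have : Nonempty (Fin n) := ⟨i⟩
  obtain ⟨j, hj⟩ := exists_eq_ciSup_of_finite (f := fun k => A i k * tpow A m k l)
  refine ⟨j, ?_⟩
  simp only [tpow, tmul, Matrix.of_apply]
  exact hj.symm

lemma tpow_mul_le {n : ℕ} (A : Matrix (Fin n) (Fin n) ℝ) (hA : ∀ i j, 0 ≤ A i j) (b a : ℕ) :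
    ∀ i j l, tpow A a i j * tpow A b j l ≤ tpow A (a + b) i l := by
  induction a with
  | zero =>
    intro i j l
    by_cases h : i = j
    · subst h; simp [tpow]
    · have := tpow_nonneg A hA b i l
      simpa [tpow, h] using this
  | succ a ih =>
    intro i j l
    obtain ⟨k, hk⟩ := exists_tpow_succ A a i j
    rw [hk, mul_assoc, show a + 1 + b = (a + b) + 1 by ring]
    exact (mul_le_mul_of_nonneg_left (ih k j l) (hA i k)).trans (le_tpow_succ A _ i k l)

lemma walk_le {n : ℕ} (A : Matrix (Fin n) (Fin n) ℝ) (hA : ∀ i j, 0 ≤ A i j) (p : ℕ → Fin n)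
    (m : ℕ) : ∀ a, ∏ k ∈ Finset.range m, A (p (a + k)) (p (a + k + 1)) ≤
      tpow A m (p a) (p (a + m)) := by
  induction m with
  | zero => intro a; simp [tpow]
  | succ m ih =>
    intro a
    rw [Finset.prod_range_succ']
    have h1 := ih (a + 1)
    have h2 := le_tpow_succ A m (p a) (p (a + 1)) (p (a + 1 + m))
    have h3 := mul_le_mul_of_nonneg_left h1 (hA (p a) (p (a + 1)))
    rw [mul_comm]
    have e : a + (m + 1) = a + 1 + m := by ring
    rw [e]
    refine le_trans (le_of_eq ?_) (h3.trans h2)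
    congr 1
    refine Finset.prod_congr rfl fun k _ => ?_
    rw [show a + (k + 1) = a + 1 + k by ring]

lemma exists_walk {n : ℕ} (A : Matrix (Fin n) (Fin n) ℝ) (hA : ∀ i j, 0 ≤ A i j)
    (m : ℕ) : ∀ i l, 0 < tpow A m i l → ∃ p : ℕ → Fin n, p 0 = i ∧ p m = l ∧
      tpow A m i l = ∏ k ∈ Finset.range m, A (p k) (p (k + 1)) := by
  induction m with
  | zero =>
    intro i l h
    have : i = l := by
      by_contra hne
      simp [tpow, hne] at h
    subst this
    exact ⟨fun _ => i, rfl, rfl, by simp [tpow]⟩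
  | succ m ih =>
    intro i l h
    obtain ⟨j, hj⟩ := exists_tpow_succ A m i l
    rw [hj] at h ⊢
    have hp : 0 < tpow A m j l := pos_of_mul_pos_right h (hA i j)
    obtain ⟨p, h0, hm, hw⟩ := ih j l hp
    refine ⟨fun k => Nat.casesOn k i p, rfl, hm, ?_⟩
    rw [Finset.prod_range_succ', hw, mul_comm]
    simp [h0]

lemma diag_le {n : ℕ} (A : Matrix (Fin n) (Fin n) ℝ) (hTr : tTr A ≤ 1) (c : ℕ) (hc : 1 ≤ c)
    (hcn : c ≤ n) (j : Fin n) : tpow A c j j ≤ 1 := by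
  obtain ⟨d, rfl⟩ : ∃ d, c = d + 1 := ⟨c - 1, by omega⟩
  refine le_trans ?_ hTr
  refine le_trans ?_ (le_ciSup (f := fun k : Fin n => ttr (tpow A (k.1 + 1))) (bddF _) ⟨d, by omega⟩)
  exact le_ciSup (f := fun i => tpow A (d + 1) i i) (bddF _) j

lemma tpow_le_star {n : ℕ} (A : Matrix (Fin n) (Fin n) ℝ) (m : ℕ) (hm : m < n) (i j : Fin n) :
    tpow A m i j ≤ kstar A i j := by
  simp only [kstar, Matrix.of_apply]
  exact le_ciSup (f := fun k : Fin n => tpow A k.1 i j) (bddF _) ⟨m, hm⟩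

lemma tpow_n_le {n : ℕ} (A : Matrix (Fin n) (Fin n) ℝ) (hA : ∀ i j, 0 ≤ A i j)
    (hTr : tTr A ≤ 1) (i l : Fin n) : tpow A n i l ≤ kstar A i l := by
  by_cases hpos : 0 < tpow A n i l
  · obtain ⟨p, h0, hn, hw⟩ := exists_walk A hA n i l hpos
    obtain ⟨a, b, hab, hbn, hpab⟩ : ∃ a b : ℕ, a < b ∧ b ≤ n ∧ p a = p b := by
      obtain ⟨s, t, hne, hst⟩ := Fintype.exists_ne_map_eq_of_card_lt
        (fun k : Fin (n + 1) => p k.1) (by simp)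
      have hne' : s.1 ≠ t.1 := fun h => hne (Fin.ext h)
      rcases lt_or_gt_of_ne hne' with h | h
      · exact ⟨s, t, h, by omega, hst⟩
      · exact ⟨t, s, h, by omega, hst.symm⟩
    obtain ⟨c, rfl⟩ : ∃ c, b = a + c := ⟨b - a, by omega⟩
    obtain ⟨d, hd⟩ : ∃ d, n = a + c + d := ⟨n - (a + c), by omega⟩
    have w1 := walk_le A hA p a 0
    have w2 := walk_le A hA p c a
    have w3 := walk_le A hA p d (a + c)
    simp only [zero_add] at w1
    rw [h0] at w1
    rw [← hd, hn, ← hpab] at w3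
    rw [← hpab] at w2
    have w2' := w2.trans (diag_le A hTr c (by omega) (by omega) (p a))
    have hsplit : tpow A n i l = (∏ k ∈ Finset.range a, A (p k) (p (k + 1))) *
        (∏ k ∈ Finset.range c, A (p (a + k)) (p (a + k + 1))) *
        (∏ k ∈ Finset.range d, A (p (a + c + k)) (p (a + c + k + 1))) := by
      rw [hw, ← Finset.prod_range_add (fun k => A (p k) (p (k + 1))),
        ← Finset.prod_range_add (fun k => A (p k) (p (k + 1))), ← hd]
    have q1 : 0 ≤ ∏ k ∈ Finset.range a, A (p k) (p (k + 1)) :=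
      Finset.prod_nonneg fun _ _ => hA _ _
    have q3 : 0 ≤ ∏ k ∈ Finset.range d, A (p (a + c + k)) (p (a + c + k + 1)) :=
      Finset.prod_nonneg fun _ _ => hA _ _
    rw [hsplit]
    calc _ ≤ (∏ k ∈ Finset.range a, A (p k) (p (k + 1))) *
        (∏ k ∈ Finset.range d, A (p (a + c + k)) (p (a + c + k + 1))) :=
          mul_le_mul_of_nonneg_right (mul_le_of_le_one_right q1 w2') q3
      _ ≤ tpow A a i (p a) * tpow A d (p a) l :=
          mul_le_mul w1 w3 q3 (tpow_nonneg A hA _ _ _)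
      _ ≤ tpow A (a + d) i l := tpow_mul_le A hA d a i (p a) l
      _ ≤ _ := tpow_le_star A (a + d) (by omega) i l
  · refine (not_lt.mp hpos).trans ?_
    exact (tpow_nonneg A hA 0 i l).trans (tpow_le_star A 0 i.pos i l)

/-- if `Tr(A) ≤ 1`, positive solutions of `A ⊗ x ≤ x` are exactly `x = A* ⊗ u`. -/
theorem stmt1 {n : ℕ} (A : Matrix (Fin n) (Fin n) ℝ) (hA : ∀ i j, 0 ≤ A i j)
    (hTr : tTr A ≤ 1) (x : Fin n → ℝ) (hx : ∀ i, 0 < x i) :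
    (∀ i, (⨆ j, A i j * x j) ≤ x i) ↔
      ∃ u : Fin n → ℝ, (∀ i, 0 < u i) ∧ ∀ i, x i = ⨆ j, kstar A i j * u j := by
  constructor
  · intro h
    refine ⟨x, hx, fun i => ?_⟩
    have : Nonempty (Fin n) := ⟨i⟩
    have h1 : ∀ i j, A i j * x j ≤ x i := fun i j =>
      (le_ciSup (f := fun j => A i j * x j) (bddF _) j).trans (h i)
    have h2 : ∀ m i j, tpow A m i j * x j ≤ x i := by
      intro m
      induction m with
      | zero =>
        intro i j
        by_cases e : i = j
        · subst e; simp [tpow]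
        · simpa [tpow, e] using (hx i).le
      | succ m ih =>
        intro i j
        obtain ⟨k, hk⟩ := exists_tpow_succ A m i j
        rw [hk, mul_assoc]
        exact (mul_le_mul_of_nonneg_left (ih k j) (hA i k)).trans (h1 i k)
    apply le_antisymm
    · refine le_trans ?_ (le_ciSup (f := fun j => kstar A i j * x j) (bddF _) i)
      have := tpow_le_star A 0 i.pos i i
      have e : tpow A 0 i i = 1 := by simp [tpow]
      rw [e] at this
      exact le_mul_of_one_le_left (hx i).le this
    · refine ciSup_le fun j => ?_
      obtain ⟨k, hk⟩ := exists_eq_ciSup_of_finite (f := fun k : Fin n => tpow A k.1 i j)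
      have e : kstar A i j = tpow A k.1 i j := hk.symm
      rw [e]
      exact h2 _ i j
  · rintro ⟨u, hu, hxu⟩ i
    have : Nonempty (Fin n) := ⟨i⟩
    refine ciSup_le fun j => ?_
    obtain ⟨l, hl⟩ := exists_eq_ciSup_of_finite (f := fun l => kstar A j l * u l)
    obtain ⟨k, hk⟩ := exists_eq_ciSup_of_finite (f := fun k : Fin n => tpow A k.1 j l)
    have e : kstar A j l = tpow A k.1 j l := hk.symm
    have hxj : x j = tpow A k.1 j l * u l := by rw [hxu j, ← hl, e]
    have hle : tpow A (k.1 + 1) i l ≤ kstar A i l := by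
      rcases Nat.lt_or_ge (k.1 + 1) n with h | h
      · exact tpow_le_star A _ h i l
      · have hkn : k.1 + 1 = n := by omega
        have := tpow_n_le A hA hTr i l
        rw [hkn]
        exact this
    rw [hxj, ← mul_assoc, hxu i]
    exact (mul_le_mul_of_nonneg_right ((le_tpow_succ A k.1 i j l).trans hle) (hu l).le).trans
      (le_ciSup (f := fun j => kstar A i j * u j) (bddF _) l)
end
end

section
/- Let A be an n×n matrix with nonnegative real entries such that Tr(A) > 1. Then there is no positive vector x ∈ ℝⁿ (all entries > 0) satisfying max_{1≤j≤n} A_{ij}·x_j ≤ x_i for every i. -/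
open scoped BigOperators

noncomputable section

theorem tpow_bound_aux {n : ℕ} (A : Matrix (Fin n) (Fin n) ℝ) (hA : ∀ i j, 0 ≤ A i j)
    (x : Fin n → ℝ) (hx : ∀ i, 0 < x i) (h : ∀ i j, A i j * x j ≤ x i) (k : ℕ) :
    ∀ i j, tpow A k i j ≤ x i / x j := by
  induction k with
  | zero =>
    intro i j
    simp only [tpow, Matrix.of_apply]
    split_ifs with hij
    · subst hij
      rw [div_self (hx i).ne']
    · exact (div_pos (hx i) (hx j)).le
  | succ k ih =>
    intro i j
    simp only [tpow, tmul, Matrix.of_apply]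
    haveI : Nonempty (Fin n) := ⟨i⟩
    refine ciSup_le fun l => ?_
    calc A i l * tpow A k l j ≤ A i l * (x l / x j) :=
          mul_le_mul_of_nonneg_left (ih l j) (hA i l)
      _ = A i l * x l / x j := by ring
      _ ≤ x i / x j := div_le_div_of_nonneg_right (h i l) (hx j).le

/-- if `Tr(A) > 1`, there is no positive solution of `A ⊗ x ≤ x`. -/
theorem stmt2 {n : ℕ} (A : Matrix (Fin n) (Fin n) ℝ) (hA : ∀ i j, 0 ≤ A i j)
    (hTr : 1 < tTr A) :
    ¬ ∃ x : Fin n → ℝ, (∀ i, 0 < x i) ∧ ∀ i, (⨆ j, A i j * x j) ≤ x i := by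
  rintro ⟨x, hx, h⟩
  have h' : ∀ i j, A i j * x j ≤ x i := fun i j =>
    (le_ciSup (f := fun j => A i j * x j) (Set.finite_range _).bddAbove j).trans (h i)
  refine absurd hTr (not_lt.mpr ?_)
  unfold tTr ttr
  refine Real.iSup_le (fun k => Real.iSup_le (fun i => ?_) zero_le_one) zero_le_one
  have := tpow_bound_aux A hA x hx h' (k.1 + 1) i i
  rwa [div_self (hx i).ne'] at this
end
end

section
/- Let A and B be n×n matrices with nonnegative real entries whose tropical spectral radii μ = λ(A) and ν = λ(B) are positive, and let G and H be the associated functions; suppose μ < G(ν). Then for every α with μ ≤ α ≤ G(ν) and β = H(α), the set of positive vectors x ∈ ℝⁿ satisfying max_{i,j} A_{ij}·x_j/x_i ≤ α and max_{i,j} B_{ij}·x_j/x_i ≤ β is exactly the set of vectors of the form x = (α⁻¹A ⊕ β⁻¹B)* ⊗ u with u ∈ ℝⁿ a positive vector. -/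
open scoped BigOperators

noncomputable section

section helpers
variable {n : ℕ}

def NN (X : Matrix (Fin n) (Fin n) ℝ) : Prop := ∀ i j, 0 ≤ X i j

lemma le_tmul (X Y : Matrix (Fin n) (Fin n) ℝ) (i k j : Fin n) :
    X i k * Y k j ≤ tmul X Y i j := by
  have := le_ciSup (f := fun k => X i k * Y k j) (Set.finite_range _).bddAbove k
  simpa [tmul] using this

lemma tmul_att (X Y : Matrix (Fin n) (Fin n) ℝ) (i j : Fin n) :
    ∃ k, tmul X Y i j = X i k * Y k j := by
  haveI : Nonempty (Fin n) := ⟨i⟩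
  obtain ⟨k, hk⟩ := exists_eq_ciSup_of_finite (f := fun k => X i k * Y k j)
  exact ⟨k, by simp only [tmul, Matrix.of_apply]; exact hk.symm⟩

lemma NN.tmul {X Y : Matrix (Fin n) (Fin n) ℝ} (hX : NN X) (hY : NN Y) : NN (tmul X Y) := by
  intro i j
  obtain ⟨k, hk⟩ := tmul_att X Y i j
  rw [hk]; exact mul_nonneg (hX _ _) (hY _ _)

lemma tmul_assoc' {X Y Z : Matrix (Fin n) (Fin n) ℝ} (hX : NN X) (hZ : NN Z) :
    tmul (tmul X Y) Z = tmul X (tmul Y Z) := by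
  ext i j
  apply le_antisymm
  · obtain ⟨k, hk⟩ := tmul_att (tmul X Y) Z i j
    obtain ⟨l, hl⟩ := tmul_att X Y i k
    rw [hk, hl, mul_assoc]
    exact (mul_le_mul_of_nonneg_left (le_tmul Y Z l k j) (hX _ _)).trans (le_tmul X _ i l j)
  · obtain ⟨k, hk⟩ := tmul_att X (tmul Y Z) i j
    obtain ⟨l, hl⟩ := tmul_att Y Z k j
    rw [hk, hl, ← mul_assoc]
    exact (mul_le_mul_of_nonneg_right (le_tmul X Y i k l) (hZ _ _)).trans (le_tmul _ Z i l j)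

lemma NN.one (X : Matrix (Fin n) (Fin n) ℝ) : NN (tpow X 0) := by
  intro i j
  simp only [tpow, Matrix.of_apply]
  split_ifs <;> norm_num

lemma NN.tpow {X : Matrix (Fin n) (Fin n) ℝ} (hX : NN X) : ∀ k, NN (tpow X k)
  | 0 => NN.one X
  | k + 1 => hX.tmul (NN.tpow hX k)

lemma one_tmul' (X : Matrix (Fin n) (Fin n) ℝ) {Y : Matrix (Fin n) (Fin n) ℝ} (hY : NN Y) :
    tmul (tpow X 0) Y = Y := by
  ext i j
  apply le_antisymm
  · obtain ⟨k, hk⟩ := tmul_att (tpow X 0) Y i j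
    rw [hk]
    simp only [tpow, Matrix.of_apply]
    split_ifs with h
    · subst h; simp
    · simpa using hY i j
  · have := le_tmul (tpow X 0) Y i i j
    simpa [tpow] using this

lemma tmul_one' (X : Matrix (Fin n) (Fin n) ℝ) {Y : Matrix (Fin n) (Fin n) ℝ} (hY : NN Y) :
    tmul Y (tpow X 0) = Y := by
  ext i j
  apply le_antisymm
  · obtain ⟨k, hk⟩ := tmul_att Y (tpow X 0) i j
    rw [hk]
    simp only [tpow, Matrix.of_apply]
    split_ifs with h
    · subst h; simp
    · simpa using hY i j
  · have := le_tmul Y (tpow X 0) i j j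
    simpa [tpow] using this

lemma tpow_add' {X : Matrix (Fin n) (Fin n) ℝ} (hX : NN X) (p q : ℕ) :
    tpow X (p + q) = tmul (tpow X p) (tpow X q) := by
  induction p with
  | zero => rw [Nat.zero_add, one_tmul' X (hX.tpow q)]
  | succ p ih =>
    rw [Nat.succ_add]
    change tmul X (tpow X (p + q)) = tmul (tmul X (tpow X p)) (tpow X q)
    rw [ih, tmul_assoc' hX (hX.tpow q)]

lemma le_ttr (X : Matrix (Fin n) (Fin n) ℝ) (i : Fin n) : X i i ≤ ttr X :=
  le_ciSup (f := fun i => X i i) (Set.finite_range _).bddAbove i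

lemma ttr_nonneg' {X : Matrix (Fin n) (Fin n) ℝ} (hX : NN X) : 0 ≤ ttr X :=
  Real.iSup_nonneg fun i => hX i i

lemma NN.wordProd {A B : Matrix (Fin n) (Fin n) ℝ} (hA : NN A) (hB : NN B) :
    ∀ l, NN (wordProd A B l)
  | [] => NN.one A
  | i :: l => (hB.tmul (hA.tpow i)).tmul (NN.wordProd hA hB l)

def PW (A B : Matrix (Fin n) (Fin n) ℝ) : List Bool → Matrix (Fin n) (Fin n) ℝ
  | [] => tpow A 0
  | true :: w => tmul B (PW A B w)
  | false :: w => tmul A (PW A B w)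

lemma PW_dec {A B : Matrix (Fin n) (Fin n) ℝ} (hA : NN A) (hB : NN B) (w : List Bool) :
    ∃ (p : ℕ) (l : List ℕ), PW A B w = tmul (tpow A p) (wordProd A B l) ∧
      l.length = w.count true ∧ p + l.sum = w.count false := by
  induction w with
  | nil => exact ⟨0, [], by simp [PW, wordProd, one_tmul' A (NN.one A)], by simp, by simp⟩
  | cons b w ih =>
    obtain ⟨p, l, h1, h2, h3⟩ := ih
    cases b
    · refine ⟨p + 1, l, ?_, by simpa using h2, by simp; omega⟩
      change tmul A (PW A B w) = tmul (tmul A (tpow A p)) _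
      rw [h1, tmul_assoc' hA (hA.wordProd hB l)]
    · refine ⟨0, p :: l, ?_, by simpa using h2, by simpa using h3⟩
      rw [one_tmul' A (hA.wordProd hB _)]
      change tmul B (PW A B w) = tmul (tmul B (tpow A p)) _
      rw [h1, tmul_assoc' hB (hA.wordProd hB l)]

lemma PW_B {A B : Matrix (Fin n) (Fin n) ℝ} (w : List Bool) (h : w.count false = 0) :
    PW A B w = tpow B w.length := by
  induction w with
  | nil => rfl
  | cons b w ih =>
    cases b
    · simp at h
    · change tmul B (PW A B w) = tmul B (tpow B w.length)
      rw [ih (by simpa using h)]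

lemma absorb {A B : Matrix (Fin n) (Fin n) ℝ} (hA : NN A) (hB : NN B) (p : ℕ) (l : List ℕ)
    (hl : l ≠ []) : ∃ l' : List ℕ, tmul (wordProd A B l) (tpow A p) = wordProd A B l' ∧
      l'.length = l.length ∧ l'.sum = l.sum + p := by
  induction l with
  | nil => exact absurd rfl hl
  | cons i l ih =>
    by_cases h : l = []
    · subst h
      refine ⟨[i + p], ?_, by simp, by simp⟩
      change tmul (tmul (tmul B (tpow A i)) (tpow A 0)) (tpow A p) =
        tmul (tmul B (tpow A (i + p))) (tpow A 0)
      rw [tmul_one' A (hB.tmul (hA.tpow _)), tmul_one' A (hB.tmul (hA.tpow _)),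
        tmul_assoc' hB (hA.tpow p), tpow_add' hA]
    · obtain ⟨l', h1, h2, h3⟩ := ih h
      refine ⟨i :: l', ?_, by simp [h2], by simp [h3, add_assoc]⟩
      change tmul (tmul (tmul B (tpow A i)) (wordProd A B l)) (tpow A p) =
        tmul (tmul B (tpow A i)) (wordProd A B l')
      rw [tmul_assoc' (hB.tmul (hA.tpow _)) (hA.tpow p), h1]

lemma ttr_comm_le (X Y : Matrix (Fin n) (Fin n) ℝ) (i : Fin n) :
    tmul X Y i i ≤ ttr (tmul Y X) := by
  obtain ⟨k, hk⟩ := tmul_att X Y i i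
  rw [hk, mul_comm]
  exact (le_tmul Y X k i k).trans (le_ttr _ k)

lemma ttr_pow_le {A : Matrix (Fin n) (Fin n) ℝ} (hA : NN A) {L : ℕ} (h1 : 1 ≤ L) (h2 : L ≤ n) :
    ttr (tpow A L) ≤ specRad A ^ L := by
  obtain ⟨k, rfl⟩ := Nat.exists_eq_add_of_le' h1
  have h := le_ciSup (f := fun k : Fin n => (ttr (tpow A (k.1 + 1))) ^ ((1 : ℝ) / ((k.1 : ℝ) + 1)))
    (Set.finite_range _).bddAbove ⟨k, h2⟩
  have h0 := ttr_nonneg' (hA.tpow (k + 1))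
  have h' : (ttr (tpow A (k + 1))) ^ ((1 : ℝ) / ((k : ℝ) + 1)) ≤ specRad A := h
  have h3 := pow_le_pow_left₀ (Real.rpow_nonneg h0 _) h' (k + 1)
  rwa [← Real.rpow_natCast, ← Real.rpow_mul h0, show (1 : ℝ) / ((k : ℝ) + 1) * ((k + 1 : ℕ) : ℝ) = 1 by
    push_cast; field_simp, Real.rpow_one] at h3

lemma idx_finite (F : ℕ → ℕ → ℝ → ℝ) (A B : Matrix (Fin n) (Fin n) ℝ) :
    { v : ℝ | ∃ (k m : ℕ) (t : Fin k → ℕ),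
    1 ≤ k ∧ k ≤ n - 1 ∧ 1 ≤ m ∧ m ≤ n - k ∧ (∑ j, t j) = m ∧
    v = F k m (ttr (wordProd A B (List.ofFn t))) }.Finite := by
  have : (⋃ k ∈ Set.Iic n, ⋃ m ∈ Set.Iic n,
      (fun t : Fin k → ℕ => F k m (ttr (wordProd A B (List.ofFn t)))) ''
        (Finset.piAntidiag Finset.univ m : Finset (Fin k → ℕ))).Finite := by
    refine (Set.finite_Iic n).biUnion fun k _ => (Set.finite_Iic n).biUnion fun m _ => ?_
    exact (Finset.finite_toSet _).image _
  refine this.subset ?_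
  rintro v ⟨k, m, t, h1, h2, h3, h4, h5, rfl⟩
  simp only [Set.mem_iUnion]
  refine ⟨k, by simp; omega, m, by simp; omega, t, by simp [h5], rfl⟩

lemma G_att {A B : Matrix (Fin n) (Fin n) ℝ} {s : ℝ} (h : 0 < Gfun A B s) :
    ∃ (k m : ℕ) (t : Fin k → ℕ),
    1 ≤ k ∧ k ≤ n - 1 ∧ 1 ≤ m ∧ m ≤ n - k ∧ (∑ j, t j) = m ∧
    Gfun A B s = s ^ (-(k : ℝ) / (m : ℝ)) *
      (ttr (wordProd A B (List.ofFn t))) ^ ((1 : ℝ) / (m : ℝ)) := by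
  have hf := idx_finite (fun k m x => s ^ (-(k : ℝ) / (m : ℝ)) * x ^ ((1 : ℝ) / (m : ℝ))) A B
  have hne := Set.nonempty_iff_ne_empty.2 (fun he => by
    have : Gfun A B s = sSup ∅ := congrArg sSup he
    rw [this, Real.sSup_empty] at h
    exact lt_irrefl _ h)
  exact hne.csSup_mem hf

lemma H_le {A B : Matrix (Fin n) (Fin n) ℝ} (t : ℝ) (k m : ℕ) (w : Fin k → ℕ)
    (h1 : 1 ≤ k) (h2 : k ≤ n - 1) (h3 : 1 ≤ m) (h4 : m ≤ n - k) (h5 : (∑ j, w j) = m) :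
    t ^ (-(m : ℝ) / (k : ℝ)) * (ttr (wordProd A B (List.ofFn w))) ^ ((1 : ℝ) / (k : ℝ))
      ≤ Hfun A B t := by
  have hf := idx_finite (fun k m x => t ^ (-(m : ℝ) / (k : ℝ)) * x ^ ((1 : ℝ) / (k : ℝ))) A B
  exact le_csSup hf.bddAbove ⟨k, m, w, h1, h2, h3, h4, h5, rfl⟩

lemma pow_form {s T : ℝ} (hs : 0 < s) (hT : 0 ≤ T) {k m : ℕ} (hm : 1 ≤ m) :
    (s ^ (-(k : ℝ) / (m : ℝ)) * T ^ ((1 : ℝ) / (m : ℝ))) ^ m * s ^ k = T := by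
  have hm' : (m : ℝ) ≠ 0 := by positivity
  rw [mul_pow, ← Real.rpow_natCast, ← Real.rpow_natCast, ← Real.rpow_mul hs.le, ← Real.rpow_mul hT,
    div_mul_cancel₀ _ hm', div_mul_cancel₀ _ hm', Real.rpow_one, Real.rpow_neg hs.le,
    Real.rpow_natCast]
  field_simp

lemma nu_le {A B : Matrix (Fin n) (Fin n) ℝ} (hA : NN A) (hB : NN B) {α ν : ℝ} (hα : 0 < α)
    (hν : 0 < ν) (h : α ≤ Gfun A B ν) : ν ≤ Hfun A B α := by
  obtain ⟨k, m, t, h1, h2, h3, h4, h5, h6⟩ := G_att (hα.trans_le h)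
  refine le_trans ?_ (H_le α k m t h1 h2 h3 h4 h5)
  have hT := ttr_nonneg' (hA.wordProd hB (List.ofFn t))
  have e1 := pow_form (k := k) (m := m) hν hT h3
  have e2 := pow_form (k := m) (m := k) hα hT h1
  rw [← h6] at e1
  have h7 : α ^ m * ν ^ k ≤ Gfun A B ν ^ m * ν ^ k := by gcongr
  rw [e1, ← e2, mul_comm] at h7
  have h8 := le_of_mul_le_mul_right h7 (by positivity)
  refine (pow_le_pow_iff_left₀ hν.le ?_ (by omega)).1 h8
  exact mul_nonneg (Real.rpow_nonneg hα.le _) (Real.rpow_nonneg hT _)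

lemma mixed {A B : Matrix (Fin n) (Fin n) ℝ} (hA : NN A) (hB : NN B) {α : ℝ} (hα : 0 < α)
    (l : List ℕ) (h1 : 1 ≤ l.length) (h3 : 1 ≤ l.sum) (h4 : l.length + l.sum ≤ n) :
    ttr (wordProd A B l) ≤ Hfun A B α ^ l.length * α ^ l.sum := by
  have h := H_le (A := A) (B := B) α l.length l.sum l.get h1 (by omega) h3 (by omega)
    (by rw [← List.sum_ofFn, List.ofFn_get])
  rw [List.ofFn_get] at h
  have hT := ttr_nonneg' (hA.wordProd hB l)
  conv_lhs => rw [← pow_form (k := l.sum) (m := l.length) hα hT h1]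
  have : 0 ≤ α ^ (-(l.sum : ℝ) / (l.length : ℝ)) * ttr (wordProd A B l) ^ ((1 : ℝ) / (l.length : ℝ)) :=
    mul_nonneg (Real.rpow_nonneg hα.le _) (Real.rpow_nonneg hT _)
  gcongr

lemma PW_diag {A B : Matrix (Fin n) (Fin n) ℝ} (hA : NN A) (hB : NN B) {α β : ℝ} (hα : 0 < α)
    (hμ0 : 0 ≤ specRad A) (hν0 : 0 ≤ specRad B)
    (hμ : specRad A ≤ α) (hν : specRad B ≤ β) (hβ : β = Hfun A B α) (w : List Bool)
    (h1 : 1 ≤ w.length) (h2 : w.length ≤ n) (i : Fin n) :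
    PW A B w i i ≤ α ^ w.count false * β ^ w.count true := by
  have hc : w.count false + w.count true = w.length := by
    have := List.count_not_add_count w true
    simpa using this
  by_cases hf : w.count false = 0
  · rw [PW_B w hf, hf, ← hc, hf]
    simp only [pow_zero, one_mul, zero_add]
    exact (le_ttr _ i).trans ((ttr_pow_le hB (by omega) (by omega)).trans (by gcongr))
  obtain ⟨p, l, e1, e2, e3⟩ := PW_dec hA hB w
  by_cases hl : l = []
  · subst hl
    simp at e2 e3
    rw [e1, ← e3, ← e2]
    change tmul (tpow A p) (tpow A 0) i i ≤ _
    rw [tmul_one' A (hA.tpow p)]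
    simp only [pow_zero, mul_one]
    exact (le_ttr _ i).trans ((ttr_pow_le hA (by omega) (by omega)).trans (by gcongr))
  · obtain ⟨l', f1, f2, f3⟩ := absorb hA hB p l hl
    have hl' := List.length_pos_iff.2 hl
    have key := mixed hA hB hα l' (by omega) (by omega) (by omega)
    rw [e1]
    refine (ttr_comm_le _ _ i).trans ?_
    rw [f1]
    refine key.trans (le_of_eq ?_)
    rw [← hβ, f2, e2, show l'.sum = w.count false by omega, mul_comm]

def MM (A B : Matrix (Fin n) (Fin n) ℝ) (α β : ℝ) : Matrix (Fin n) (Fin n) ℝ :=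
  Matrix.of fun i' j' => max (A i' j' / α) (B i' j' / β)

lemma MM_word {A B : Matrix (Fin n) (Fin n) ℝ} (hA : NN A) (hB : NN B) {α β : ℝ} (hα : 0 < α)
    (hβ : 0 < β) (L : ℕ) (i j : Fin n) : ∃ w : List Bool, w.length = L ∧
      tpow (MM A B α β) L i j * (α ^ w.count false * β ^ w.count true) ≤ PW A B w i j := by
  induction L generalizing i with
  | zero => exact ⟨[], rfl, by simp [PW, tpow]⟩
  | succ L ih =>
    obtain ⟨k, hk⟩ := tmul_att (MM A B α β) (tpow (MM A B α β) L) i j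
    obtain ⟨w, hw, hle⟩ := ih k
    change ∃ w : List Bool, w.length = L + 1 ∧ tmul (MM A B α β) (tpow (MM A B α β) L) i j * _ ≤ _
    rw [hk]
    set x := tpow (MM A B α β) L k j
    rcases max_choice (A i k / α) (B i k / β) with hm | hm
    · refine ⟨false :: w, by simp [hw], ?_⟩
      refine le_trans (le_of_eq ?_) ((mul_le_mul_of_nonneg_left hle (hA i k)).trans
        (le_tmul A (PW A B w) i k j))
      simp only [MM, Matrix.of_apply, hm, List.count_cons]
      simp
      field_simp
      ring
    · refine ⟨true :: w, by simp [hw], ?_⟩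
      refine le_trans (le_of_eq ?_) ((mul_le_mul_of_nonneg_left hle (hB i k)).trans
        (le_tmul B (PW A B w) i k j))
      simp only [MM, Matrix.of_apply, hm, List.count_cons]
      simp
      field_simp
      ring

lemma walk_att (M : Matrix (Fin n) (Fin n) ℝ) (L : ℕ) (i j : Fin n) (h0 : tpow M L i j ≠ 0) :
    ∃ v : ℕ → Fin n, v 0 = i ∧ v L = j ∧
      tpow M L i j = ∏ t ∈ Finset.range L, M (v t) (v (t + 1)) := by
  induction L generalizing i with
  | zero =>
    have hij : i = j := by
      by_contra hne
      exact h0 (by simp [tpow, hne])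
    subst hij
    exact ⟨fun _ => i, rfl, rfl, by simp [tpow]⟩
  | succ L ih =>
    obtain ⟨k, hk⟩ := tmul_att M (tpow M L) i j
    have hk' : tpow M (L + 1) i j = M i k * tpow M L k j := hk
    obtain ⟨v, a1, a2, a3⟩ := ih k (fun h => h0 (by rw [hk', h, mul_zero]))
    refine ⟨fun t => Nat.casesOn t i v, rfl, a2, ?_⟩
    rw [hk', Finset.prod_range_succ', mul_comm, a3]
    simp [a1]

lemma walk_le_s4 {M : Matrix (Fin n) (Fin n) ℝ} (hM : NN M) (v : ℕ → Fin n) (L s : ℕ) :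
    ∏ t ∈ Finset.range L, M (v (s + t)) (v (s + t + 1)) ≤ tpow M L (v s) (v (s + L)) := by
  induction L generalizing s with
  | zero => simp [tpow]
  | succ L ih =>
    rw [Finset.prod_range_succ', mul_comm]
    refine le_trans ?_ (le_tmul M (tpow M L) (v s) (v (s + 1)) (v (s + (L + 1))))
    have := ih (s + 1)
    have e : ∀ t, s + 1 + t = s + (t + 1) := fun t => by omega
    simp only [e] at this
    exact mul_le_mul_of_nonneg_left this (hM _ _)

lemma le_tkstar (M : Matrix (Fin n) (Fin n) ℝ) (k : ℕ) (hk : k < n) (i j : Fin n) :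
    tpow M k i j ≤ kstar M i j := by
  have := le_ciSup (f := fun k : Fin n => tpow M k.1 i j) (Set.finite_range _).bddAbove ⟨k, hk⟩
  simpa [kstar] using this

lemma kstar_att (M : Matrix (Fin n) (Fin n) ℝ) (i j : Fin n) :
    ∃ k : ℕ, k < n ∧ kstar M i j = tpow M k i j := by
  haveI : Nonempty (Fin n) := ⟨i⟩
  obtain ⟨k, hk⟩ := exists_eq_ciSup_of_finite (f := fun k : Fin n => tpow M k.1 i j)
  exact ⟨k.1, k.2, by simp only [kstar, Matrix.of_apply]; exact hk.symm⟩

lemma NN.kstar {M : Matrix (Fin n) (Fin n) ℝ} (hM : NN M) : NN (kstar M) := by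
  intro i j
  obtain ⟨k, _, h⟩ := kstar_att M i j
  rw [h]; exact hM.tpow k i j

lemma tpow_le_kstar {M : Matrix (Fin n) (Fin n) ℝ} (hM : NN M)
    (hc : ∀ L, 1 ≤ L → L ≤ n → ∀ i, tpow M L i i ≤ 1) (L : ℕ) (hL : L ≤ n) (i j : Fin n) :
    tpow M L i j ≤ kstar M i j := by
  rcases hL.lt_or_eq with hL | rfl
  · exact le_tkstar M L hL i j
  by_cases h0 : tpow M L i j = 0
  · rw [h0]; exact hM.kstar i j
  obtain ⟨v, a1, a2, a3⟩ := walk_att M L i j h0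
  obtain ⟨a, b, hab, hb, hv⟩ : ∃ a b : ℕ, a < b ∧ b ≤ L ∧ v a = v b := by
    obtain ⟨x, y, hxy, he⟩ := Fintype.exists_ne_map_eq_of_card_lt
      (fun t : Fin (L + 1) => v t.1) (by simp)
    have hne : x.1 ≠ y.1 := fun h => hxy (Fin.ext h)
    rcases lt_or_gt_of_ne hne with h | h
    · exact ⟨x, y, h, by omega, he⟩
    · exact ⟨y, x, h, by omega, he.symm⟩
  obtain ⟨c, rfl⟩ := Nat.exists_eq_add_of_le hab.le
  obtain ⟨d, hd⟩ := Nat.exists_eq_add_of_le hb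
  have w1 := walk_le_s4 hM v a 0
  have w2 := walk_le_s4 hM v c a
  have w3 := walk_le_s4 hM v d (a + c)
  rw [← hd, a2, ← hv] at w3
  rw [← hv] at w2
  simp only [Nat.zero_add, a1] at w1
  have e : tpow M L i j = (∏ t ∈ Finset.range a, M (v t) (v (t + 1))) *
      (∏ t ∈ Finset.range c, M (v (a + t)) (v (a + t + 1))) *
      (∏ t ∈ Finset.range d, M (v (a + c + t)) (v (a + c + t + 1))) := by
    rw [a3, ← Finset.prod_range_add (fun t => M (v t) (v (t + 1))),
      ← Finset.prod_range_add (fun t => M (v t) (v (t + 1))), ← hd]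
  have n3 : 0 ≤ ∏ t ∈ Finset.range d, M (v (a + c + t)) (v (a + c + t + 1)) :=
    Finset.prod_nonneg fun _ _ => hM _ _
  have n2 : 0 ≤ ∏ t ∈ Finset.range c, M (v (a + t)) (v (a + t + 1)) :=
    Finset.prod_nonneg fun _ _ => hM _ _
  have w2' := w2.trans (hc c (by omega) (by omega) _)
  have m1 := hM.tpow a i (v a)
  have := mul_le_mul (mul_le_mul w1 w2' n2 m1) w3 n3 (by simpa using m1)
  rw [← e, mul_one] at this
  refine this.trans ((le_tmul _ _ i (v a) j).trans ?_)
  rw [← tpow_add' hM]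
  exact le_tkstar M (a + d) (by omega) i j

lemma obj_le {A : Matrix (Fin n) (Fin n) ℝ} {x : Fin n → ℝ} (hx : ∀ i, 0 < x i) {α : ℝ}
    (hα : 0 < α) : obj A x ≤ α ↔ ∀ i j, A i j / α * x j ≤ x i := by
  have key : ∀ i j, A i j / α * x j ≤ x i ↔ A i j * x j / x i ≤ α := by
    intro i j
    rw [div_le_iff₀ (hx i), div_mul_eq_mul_div, div_le_iff₀ hα, mul_comm α]
  simp only [key]
  constructor
  · intro h i j
    refine le_trans ?_ h
    refine le_trans ?_ (le_ciSup (f := fun i => ⨆ j, A i j * x j / x i)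
      (Set.finite_range _).bddAbove i)
    exact le_ciSup (f := fun j => A i j * x j / x i) (Set.finite_range _).bddAbove j
  · intro h
    exact Real.iSup_le (fun i => Real.iSup_le (fun j => h i j) hα.le) hα.le

lemma MM_le {A B : Matrix (Fin n) (Fin n) ℝ} {x : Fin n → ℝ} (hx : ∀ i, 0 < x i) {α β : ℝ}
    (hα : 0 < α) (hβ : 0 < β) :
    (obj A x ≤ α ∧ obj B x ≤ β) ↔ ∀ i j, MM A B α β i j * x j ≤ x i := by
  rw [obj_le hx hα, obj_le hx hβ]
  simp only [MM, Matrix.of_apply, max_mul_of_nonneg _ _ (hx _).le, max_le_iff]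
  exact ⟨fun h i j => ⟨h.1 i j, h.2 i j⟩, fun h => ⟨fun i j => (h i j).1, fun i j => (h i j).2⟩⟩

lemma main_eq {M : Matrix (Fin n) (Fin n) ℝ} (hM : NN M)
    (hc : ∀ L, 1 ≤ L → L ≤ n → ∀ i, tpow M L i i ≤ 1) (x : Fin n → ℝ) :
    ((∀ i, 0 < x i) ∧ ∀ i j, M i j * x j ≤ x i) ↔
      ∃ u : Fin n → ℝ, (∀ i, 0 < u i) ∧ x = fun i => ⨆ j, kstar M i j * u j := by
  have hle : ∀ (u : Fin n → ℝ) i j, kstar M i j * u j ≤ ⨆ j, kstar M i j * u j := fun u i j =>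
    le_ciSup (f := fun j => kstar M i j * u j) (Set.finite_range _).bddAbove j
  have h1 : ∀ i, 1 ≤ kstar M i i := fun i => by
    have := le_tkstar M 0 i.pos i i
    simpa [tpow] using this
  constructor
  · rintro ⟨hx, h⟩
    refine ⟨x, hx, ?_⟩
    have hp : ∀ k i j, tpow M k i j * x j ≤ x i := by
      intro k
      induction k with
      | zero =>
        intro i j
        by_cases hij : i = j
        · subst hij; simp [tpow]
        · simpa [tpow, hij] using (hx i).le
      | succ k ih =>
        intro i j
        obtain ⟨l, hl⟩ := tmul_att M (tpow M k) i j
        change tmul M (tpow M k) i j * x j ≤ x i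
        rw [hl, mul_assoc]
        exact (mul_le_mul_of_nonneg_left (ih l j) (hM i l)).trans (h i l)
    funext i
    apply le_antisymm
    · refine le_trans ?_ (hle x i i)
      have := mul_le_mul_of_nonneg_right (h1 i) (hx i).le
      simpa using this
    · refine Real.iSup_le (fun j => ?_) (hx i).le
      obtain ⟨k, _, hk⟩ := kstar_att M i j
      rw [hk]; exact hp k i j
  · rintro ⟨u, hu, rfl⟩
    refine ⟨fun i => ?_, fun i j => ?_⟩
    · refine lt_of_lt_of_le ?_ (hle u i i)
      exact mul_pos (lt_of_lt_of_le one_pos (h1 i)) (hu i)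
    · haveI : Nonempty (Fin n) := ⟨i⟩
      obtain ⟨l, hl⟩ := exists_eq_ciSup_of_finite (f := fun l => kstar M j l * u l)
      obtain ⟨k, hkn, hk⟩ := kstar_att M j l
      change M i j * (⨆ l, kstar M j l * u l) ≤ ⨆ l, kstar M i l * u l
      rw [← hl]
      refine le_trans ?_ (hle u i l)
      rw [hk, ← mul_assoc]
      refine mul_le_mul_of_nonneg_right ?_ (hu l).le
      exact (le_tmul M (tpow M k) i j l).trans (tpow_le_kstar hM hc (k + 1) hkn i l)

end helpers

/-- for `μ ≤ α ≤ G(ν)` and `β = H(α)`, the positive solutions of the system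
`obj A x ≤ α`, `obj B x ≤ β` are exactly the vectors `x = (α⁻¹ A ⊕ β⁻¹ B)* ⊗ u`, `u > 0`. -/
theorem stmt4 {n : ℕ} (A B : Matrix (Fin n) (Fin n) ℝ)
    (hA : ∀ i j, 0 ≤ A i j) (hB : ∀ i j, 0 ≤ B i j)
    (hμ : 0 < specRad A) (hν : 0 < specRad B)
    (h : specRad A < Gfun A B (specRad B))
    (α β : ℝ) (hα₁ : specRad A ≤ α) (hα₂ : α ≤ Gfun A B (specRad B))
    (hβ : β = Hfun A B α) :
    { x : Fin n → ℝ | (∀ i, 0 < x i) ∧ obj A x ≤ α ∧ obj B x ≤ β } =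
      { x : Fin n → ℝ | ∃ u : Fin n → ℝ, (∀ i, 0 < u i) ∧
        x = fun i => ⨆ j,
          kstar (Matrix.of fun i' j' => max (A i' j' / α) (B i' j' / β)) i j * u j } := by
  have hα : 0 < α := hμ.trans_le hα₁
  have hνβ : specRad B ≤ β := hβ ▸ nu_le (A := A) (B := B) hA hB hα hν hα₂
  have hβ0 : 0 < β := hν.trans_le hνβ
  have hM : NN (MM A B α β) := fun i j => le_max_of_le_left (div_nonneg (hA i j) hα.le)
  have hc : ∀ L, 1 ≤ L → L ≤ n → ∀ i, tpow (MM A B α β) L i i ≤ 1 := by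
    intro L hL1 hL2 i
    obtain ⟨w, hw, hle⟩ := MM_word (A := A) (B := B) hA hB hα hβ0 L i i
    have h2 := hle.trans (PW_diag hA hB hα hμ.le hν.le hα₁ hνβ hβ w (by omega) (by omega) i)
    have hpos : 0 < α ^ w.count false * β ^ w.count true := by positivity
    exact le_of_mul_le_mul_right (by simpa using h2) hpos
  ext x
  rw [Set.mem_setOf_eq, Set.mem_setOf_eq]
  refine Iff.trans ?_ (main_eq hM hc x)
  exact and_congr_right fun hx => MM_le hx hα hβ0
end
end

section
/- Let A and B be 2×2 matrices with positive real entries, let μ = λ(A) and ν = λ(B) be their tropical spectral radii, and set c = max(A₁₁·B₁₁, A₁₂·B₂₁, A₂₁·B₁₂, A₂₂·B₂₂) (which equals tr(B⊗A)). If μ·ν < c, then the Pareto frontier of the problem of minimizing (f(x), g(x)) over positive vectors x ∈ ℝ² equals the set {(α, c/α) : μ ≤ α ≤ c/ν}. -/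
open scoped BigOperators

noncomputable section

lemma iSup_fin2 (f : Fin 2 → ℝ) : (⨆ i, f i) = max (f 0) (f 1) := by
  apply le_antisymm
  · apply ciSup_le
    intro i
    fin_cases i
    · exact le_max_left _ _
    · exact le_max_right _ _
  · have hb : BddAbove (Set.range f) := (Set.finite_range f).bddAbove
    exact max_le (le_ciSup hb 0) (le_ciSup hb 1)

lemma tpow_one2 (A : Matrix (Fin 2) (Fin 2) ℝ) (hA : ∀ i j, 0 < A i j) : tpow A 1 = A := by
  ext i j
  have h0 := hA i 0
  have h1 := hA i 1
  fin_cases j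
  · simp [tpow, tmul, iSup_fin2, h0.le]
  · simp [tpow, tmul, iSup_fin2, h1.le]

lemma specRad2 (A : Matrix (Fin 2) (Fin 2) ℝ) (hA : ∀ i j, 0 < A i j) :
    specRad A = max (max (A 0 0) (A 1 1))
      (Real.sqrt (max (max (A 0 0 * A 0 0) (A 0 1 * A 1 0))
        (max (A 1 0 * A 0 1) (A 1 1 * A 1 1)))) := by
  have h2 : tpow A 2 = tmul A A := by
    conv_rhs => rw [← tpow_one2 A hA]
    rw [show tmul (tpow A 1) (tpow A 1) = tmul A (tpow A 1) by rw [tpow_one2 A hA]]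
    rfl
  unfold specRad
  rw [iSup_fin2]
  simp only [Fin.val_zero, Fin.val_one, zero_add, one_add_one_eq_two]
  rw [tpow_one2 A hA, h2]
  simp [ttr, tmul, iSup_fin2, Real.sqrt_eq_rpow]
  norm_num

lemma specRad_facts (A : Matrix (Fin 2) (Fin 2) ℝ) (hA : ∀ i j, 0 < A i j) :
    A 0 0 ≤ specRad A ∧ A 1 1 ≤ specRad A ∧ A 0 1 * A 1 0 ≤ specRad A * specRad A ∧
    ∀ m, A 0 0 ≤ m → A 1 1 ≤ m → A 0 1 * A 1 0 ≤ m * m → specRad A ≤ m := by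
  rw [specRad2 A hA]
  have ha := hA 0 0
  have hd := hA 1 1
  refine ⟨by simp, by simp, ?_, ?_⟩
  · set X := max (max (A 0 0 * A 0 0) (A 0 1 * A 1 0)) (max (A 1 0 * A 0 1) (A 1 1 * A 1 1)) with hX
    have h1 : A 0 1 * A 1 0 ≤ X := by simp [hX]
    have h0 : 0 ≤ X := le_trans (mul_pos (hA 0 1) (hA 1 0)).le h1
    have h2 : √X ≤ max (max (A 0 0) (A 1 1)) (√X) := le_max_right _ _
    calc _ ≤ X := h1
      _ = √X * √X := (Real.mul_self_sqrt h0).symm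
      _ ≤ _ := mul_self_le_mul_self (Real.sqrt_nonneg _) h2
  · intro m h1 h2 h3
    refine max_le (max_le h1 h2) ?_
    apply Real.sqrt_le_iff.2
    refine ⟨by linarith, ?_⟩
    rw [pow_two]
    refine max_le (max_le ?_ h3) (max_le ?_ ?_)
    · exact mul_self_le_mul_self ha.le h1
    · linarith
    · exact mul_self_le_mul_self hd.le h2

lemma obj2 (A : Matrix (Fin 2) (Fin 2) ℝ) (x : Fin 2 → ℝ) (hx : ∀ i, 0 < x i) :
    obj A x = max (max (A 0 0) (A 0 1 * x 1 / x 0)) (max (A 1 0 * x 0 / x 1) (A 1 1)) := by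
  simp [obj, iSup_fin2, (hx 0).ne', (hx 1).ne']

lemma specRad_le_obj (A : Matrix (Fin 2) (Fin 2) ℝ) (hA : ∀ i j, 0 < A i j)
    (x : Fin 2 → ℝ) (hx : ∀ i, 0 < x i) : specRad A ≤ obj A x := by
  obtain ⟨-, -, -, h⟩ := specRad_facts A hA
  rw [obj2 A x hx]
  have h0 := hx 0
  have h1 := hx 1
  have hp := hA 0 1
  have hq := hA 1 0
  apply h
  · simp
  · simp
  · have : A 0 1 * A 1 0 = (A 0 1 * x 1 / x 0) * (A 1 0 * x 0 / x 1) := by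
      field_simp
    rw [this]
    have e : A 0 1 * x 1 / x 0 ≤ max (max (A 0 0) (A 0 1 * x 1 / x 0)) (max (A 1 0 * x 0 / x 1) (A 1 1)) := by
      simp
    apply mul_le_mul e (by simp) (by positivity)
    exact le_trans (by positivity) e

/-- the abstract argument -/
lemma abstract_frontier (A B : Matrix (Fin 2) (Fin 2) ℝ) (c μ ν : ℝ) (hμ : 0 < μ) (hν : 0 < ν)
    (h : μ * ν < c)
    (h1 : ∀ x : Fin 2 → ℝ, (∀ i, 0 < x i) → μ ≤ obj A x)
    (h2 : ∀ x : Fin 2 → ℝ, (∀ i, 0 < x i) → ν ≤ obj B x)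
    (h3 : ∀ x : Fin 2 → ℝ, (∀ i, 0 < x i) → c ≤ obj A x * obj B x)
    (h4 : ∀ α, μ ≤ α → α ≤ c / ν →
      ∃ x : Fin 2 → ℝ, (∀ i, 0 < x i) ∧ obj A x = α ∧ obj B x = c / α) :
    ParetoFrontier A B = { p : ℝ × ℝ | ∃ α : ℝ, μ ≤ α ∧ α ≤ c / ν ∧ p = (α, c / α) } := by
  have hc : 0 < c := lt_trans (mul_pos hμ hν) h
  ext p
  constructor
  · rintro ⟨x, ⟨hx, hopt⟩, rfl⟩
    have e1 := h1 x hx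
    have e2 := h2 x hx
    have e3 := h3 x hx
    have hf : 0 < obj A x := lt_of_lt_of_le hμ e1
    have hle : obj A x ≤ c / ν := by
      by_contra hlt
      push Not at hlt
      obtain ⟨y, hy, y1, y2⟩ := h4 (c / ν) (by rw [le_div_iff₀ hν]; exact h.le) le_rfl
      refine hopt ⟨y, hy, by rw [y1]; exact hlt.le, ?_, ?_⟩
      · rw [y2, div_div_cancel₀ hc.ne']; exact e2
      · intro he
        have := (Prod.mk.inj he).1
        linarith
    refine ⟨obj A x, e1, hle, ?_⟩
    obtain ⟨y, hy, y1, y2⟩ := h4 _ e1 hle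
    by_contra hne
    refine hopt ⟨y, hy, y1.le, ?_, ?_⟩
    · rw [y2, div_le_iff₀ hf]; linarith
    · rw [y1, y2]; exact fun he => hne he.symm
  · rintro ⟨α, a1, a2, rfl⟩
    have hα : 0 < α := lt_of_lt_of_le hμ a1
    obtain ⟨x, hx, x1, x2⟩ := h4 α a1 a2
    refine ⟨x, ⟨hx, ?_⟩, by rw [x1, x2]⟩
    rintro ⟨y, hy, y1, y2, hne⟩
    rw [x1] at y1 hne
    rw [x2] at y2 hne
    have e1 := lt_of_lt_of_le hμ (h1 y hy)
    have e2 := lt_of_lt_of_le hν (h2 y hy)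
    have e3 := h3 y hy
    have e4 : α * (c / α) = c := by field_simp
    have e5 : 0 < c / α := div_pos hc hα
    apply hne
    have f1 : obj A y = α := by
      apply le_antisymm y1
      by_contra hlt
      push Not at hlt
      have := mul_lt_mul hlt y2 e2 hα.le
      linarith
    have f2 : obj B y = c / α := by
      rw [eq_div_iff hα.ne']
      apply le_antisymm
      · rwa [le_div_iff₀ hα] at y2
      · rw [f1] at e3; linarith
    rw [f1, f2]

lemma key_le {p p' q' ν α c : ℝ} (hp : 0 < p) (hp' : 0 < p') (hq' : 0 < q') (hν : 0 < ν)
    (hα : 0 < α) (hc : c = p * q') (h : p' * q' ≤ ν * ν) (hle : α ≤ c / ν) :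
    p' * α / p ≤ c / α := by
  rw [le_div_iff₀ hν] at hle
  rw [div_le_div_iff₀ hp hα]
  have h1 : (α * ν) * (α * ν) ≤ c * c := mul_self_le_mul_self (by positivity) hle
  have h2 : α * α * (p' * q') ≤ α * α * (ν * ν) := mul_le_mul_of_nonneg_left h (by positivity)
  have h3 : q' * (p' * α * α) ≤ q' * (c * p) := by
    have : q' * (c * p) = c * c := by rw [hc]; ring
    nlinarith
  exact le_of_mul_le_mul_left h3 hq'

theorem stmt17 (A B : Matrix (Fin 2) (Fin 2) ℝ)
    (hA : ∀ i j, 0 < A i j) (hB : ∀ i j, 0 < B i j) (c : ℝ)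
    (hc : c = max (max (A 0 0 * B 0 0) (A 0 1 * B 1 0))
      (max (A 1 0 * B 0 1) (A 1 1 * B 1 1)))
    (h : specRad A * specRad B < c) :
    ParetoFrontier A B =
      { p : ℝ × ℝ | ∃ α : ℝ, specRad A ≤ α ∧ α ≤ c / specRad B ∧ p = (α, c / α) } := by
  obtain ⟨a1, a2, a3, -⟩ := specRad_facts A hA
  obtain ⟨b1, b2, b3, -⟩ := specRad_facts B hB
  have hμ : 0 < specRad A := lt_of_lt_of_le (hA 0 0) a1
  have hν : 0 < specRad B := lt_of_lt_of_le (hB 0 0) b1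
  have hp := hA 0 1
  have hq := hA 1 0
  have hp' := hB 0 1
  have hq' := hB 1 0
  have n1 : A 0 0 * B 0 0 < c := lt_of_le_of_lt (mul_le_mul a1 b1 (hB 0 0).le hμ.le) h
  have n2 : A 1 1 * B 1 1 < c := lt_of_le_of_lt (mul_le_mul a2 b2 (hB 1 1).le hμ.le) h
  have hcc : c = A 0 1 * B 1 0 ∨ c = A 1 0 * B 0 1 := by
    rcases max_choice (max (A 0 0 * B 0 0) (A 0 1 * B 1 0))
      (max (A 1 0 * B 0 1) (A 1 1 * B 1 1)) with e | e <;> rw [e] at hc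
    · rcases max_choice (A 0 0 * B 0 0) (A 0 1 * B 1 0) with e | e <;> rw [e] at hc
      · linarith
      · exact Or.inl hc
    · rcases max_choice (A 1 0 * B 0 1) (A 1 1 * B 1 1) with e | e <;> rw [e] at hc
      · exact Or.inr hc
      · linarith
  clear hc
  refine abstract_frontier A B c _ _ hμ hν h (specRad_le_obj A hA) (specRad_le_obj B hB) ?_ ?_
  · intro x hx
    have h0 := hx 0
    have h1 := hx 1
    have eA := obj2 A x hx
    have eB := obj2 B x hx
    have u1 : A 0 1 * x 1 / x 0 ≤ obj A x := by rw [eA]; simp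
    have u2 : A 1 0 * x 0 / x 1 ≤ obj A x := by rw [eA]; simp
    have v1 : B 0 1 * x 1 / x 0 ≤ obj B x := by rw [eB]; simp
    have v2 : B 1 0 * x 0 / x 1 ≤ obj B x := by rw [eB]; simp
    have w : 0 ≤ obj A x := le_trans (by positivity) u1
    rcases hcc with e | e
    · have : c = (A 0 1 * x 1 / x 0) * (B 1 0 * x 0 / x 1) := by rw [e]; field_simp
      rw [this]
      exact mul_le_mul u1 v2 (by positivity) w
    · have : c = (A 1 0 * x 0 / x 1) * (B 0 1 * x 1 / x 0) := by rw [e]; field_simp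
      rw [this]
      exact mul_le_mul u2 v1 (by positivity) w
  · intro α l1 l2
    have hα : 0 < α := lt_of_lt_of_le hμ l1
    have sq : A 0 1 * A 1 0 ≤ α * α := le_trans a3 (mul_self_le_mul_self hμ.le l1)
    have l3 : specRad B ≤ c / α := by
      rw [le_div_iff₀ hν] at l2
      rw [le_div_iff₀ hα]; linarith
    rcases hcc with e | e
    · have k := key_le hp hp' hq' hν hα e b3 l2
      have hx : ∀ i, 0 < (![A 0 1, α] : Fin 2 → ℝ) i := by
        intro i; fin_cases i <;> simp [hp, hα]
      have t1 : A 0 1 * α / A 0 1 = α := by field_simp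
      have t2 : B 1 0 * A 0 1 / α = c / α := by rw [e]; ring
      have t3 : A 1 0 * A 0 1 / α ≤ α := by rw [div_le_iff₀ hα]; linarith
      refine ⟨_, hx, ?_, ?_⟩
      · rw [obj2 A _ hx]
        simp only [Matrix.cons_val_zero, Matrix.cons_val_one]
        rw [t1, max_eq_right (a1.trans l1)]
        exact max_eq_left (max_le t3 (a2.trans l1))
      · rw [obj2 B _ hx]
        simp only [Matrix.cons_val_zero, Matrix.cons_val_one]
        rw [t2, max_eq_left (b2.trans l3)]
        exact max_eq_right (max_le (b1.trans l3) k)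
    · have k := key_le hq hq' hp' hν hα e (by linarith) l2
      have hx : ∀ i, 0 < (![α, A 1 0] : Fin 2 → ℝ) i := by
        intro i; fin_cases i <;> simp [hq, hα]
      have t1 : A 1 0 * α / A 1 0 = α := by field_simp
      have t2 : B 0 1 * A 1 0 / α = c / α := by rw [e]; ring
      have t3 : A 0 1 * A 1 0 / α ≤ α := by rw [div_le_iff₀ hα]; linarith
      refine ⟨_, hx, ?_, ?_⟩
      · rw [obj2 A _ hx]
        simp only [Matrix.cons_val_zero, Matrix.cons_val_one]
        rw [t1, max_eq_left (a2.trans l1)]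
        exact max_eq_right (max_le (a1.trans l1) t3)
      · rw [obj2 B _ hx]
        simp only [Matrix.cons_val_zero, Matrix.cons_val_one]
        rw [t2, max_eq_right (b1.trans l3)]
        exact max_eq_left (max_le k (b2.trans l3))
end
end
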